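/- arXiv:1510.04884 — 5 statements merged into one kernel-verified Lean document; each statement's English description precedes it below -/
import Mathlib

section
/- For every weight λ, with Λ its block, there exists a unique cup diagram c compatible with Λ such that cλ is oriented and deg(cλ) = 0. (This cup diagram is denoted underline λ; it is obtained by repeatedly connecting a vertex labeled ∨ with the next vertex labeled ∧ to its right by a cup, ignoring symbols ∘ and × and already connected symbols, until no ∨ lies to the left of an unconnected ∧, and finally attaching rays to all remaining vertices labeled ∨ or ∧.) -/
namespace BK

/-- The symbols `∘, ×, ∨, ∧` labelling the integral positions of a weight. -/
inductive Symb : Type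
  | circ : Symb
  | times : Symb
  | dn : Symb
  | up : Symb
  deriving DecidableEq

/-- A (diagrammatical) weight: a sequence of symbols indexed by `ℤ`, equal to `∘`
for all but finitely many positions. -/
structure Weight : Type where
  lab : ℤ → Symb
  finite : {i : ℤ | lab i ≠ Symb.circ}.Finite

namespace Weight

/-- Two weights are equivalent (lie in the same block) if one is obtained from the
other by permuting the symbols `∧` and `∨`: the `∘`- and `×`-positions agree and the
number of `∧`'s agrees. -/
def Equiv (l m : Weight) : Prop :=
  (∀ i, l.lab i = Symb.circ ↔ m.lab i = Symb.circ) ∧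
  (∀ i, l.lab i = Symb.times ↔ m.lab i = Symb.times) ∧
  {i | l.lab i = Symb.up}.ncard = {i | m.lab i = Symb.up}.ncard

/-- The vertices of (the block of) a weight: the positions carrying `∧` or `∨`,
i.e. the positions where the block sequence has the symbol `★`. -/
def vertices (l : Weight) : Set ℤ :=
  {i | l.lab i = Symb.up ∨ l.lab i = Symb.dn}

/-- `up(Λ)`: the number of `∧`'s plus the number of `×`'s. -/
noncomputable def upNum (l : Weight) : ℕ :=
  {i | l.lab i = Symb.up}.ncard + {i | l.lab i = Symb.times}.ncard

/-- `down(Λ)`: the number of `∨`'s plus the number of `×`'s. -/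
noncomputable def downNum (l : Weight) : ℕ :=
  {i | l.lab i = Symb.dn}.ncard + {i | l.lab i = Symb.times}.ncard

/-- A block is balanced if `up(Λ) = down(Λ)`. -/
def Balanced (l : Weight) : Prop := l.upNum = l.downNum

end Weight

/-- A cup diagram (equally: the datum of a cap diagram, via the mirror image):
a set of cups `(i, j)` with `i < j` and a set of rays `i`. -/
@[ext]
structure CupDiagram : Type where
  cups : Set (ℤ × ℤ)
  rays : Set ℤ

namespace CupDiagram

/-- Compatibility of a cup diagram with the vertex set `V` of a block: endpoints lie in
`V` and are increasing, every vertex lies in exactly one arc, cups do not cross, and no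
ray lies under a cup. -/
def IsCompatible (c : CupDiagram) (V : Set ℤ) : Prop :=
  (∀ p ∈ c.cups, p.1 < p.2) ∧
  (∀ p ∈ c.cups, p.1 ∈ V ∧ p.2 ∈ V) ∧
  c.rays ⊆ V ∧
  (∀ v ∈ V, v ∈ c.rays ∨ ∃ p ∈ c.cups, v = p.1 ∨ v = p.2) ∧
  (∀ p ∈ c.cups, ∀ q ∈ c.cups,
    (p.1 = q.1 ∨ p.1 = q.2 ∨ p.2 = q.1 ∨ p.2 = q.2) → p = q) ∧
  (∀ p ∈ c.cups, p.1 ∉ c.rays ∧ p.2 ∉ c.rays) ∧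
  (∀ p ∈ c.cups, ∀ q ∈ c.cups, ¬(p.1 < q.1 ∧ q.1 < p.2 ∧ p.2 < q.2)) ∧
  (∀ p ∈ c.cups, ∀ k ∈ c.rays, ¬(p.1 < k ∧ k < p.2))

/-- The diagram `cλ` is oriented: every cup has exactly one endpoint `∨` and one `∧`,
every ray vertex is labeled `∨` or `∧`, and there are no rays `i < j` with
`λ_i = ∨` and `λ_j = ∧`. -/
def Oriented (c : CupDiagram) (l : Weight) : Prop :=
  (∀ p ∈ c.cups,
    (l.lab p.1 = Symb.dn ∧ l.lab p.2 = Symb.up) ∨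
    (l.lab p.1 = Symb.up ∧ l.lab p.2 = Symb.dn)) ∧
  (∀ k ∈ c.rays, l.lab k = Symb.up ∨ l.lab k = Symb.dn) ∧
  (∀ i ∈ c.rays, ∀ j ∈ c.rays, i < j → ¬(l.lab i = Symb.dn ∧ l.lab j = Symb.up))

/-- The degree of `cλ`: the number of clockwise cups (cups whose rightmost vertex is
labeled `∨`).  Applied to the mirror cap diagram this is the number of clockwise caps. -/
noncomputable def deg (c : CupDiagram) (l : Weight) : ℕ :=
  {p ∈ c.cups | l.lab p.2 = Symb.dn}.ncard

end CupDiagram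

/-- `c` is the cup diagram `underline l` of the weight `l`: it is compatible with the
block of `l`, the diagram `c l` is oriented, and `deg (c l) = 0`. -/
def IsLowerDiagram (c : CupDiagram) (l : Weight) : Prop :=
  c.IsCompatible l.vertices ∧ c.Oriented l ∧ c.deg l = 0

/-- Adjacency of vertices in the circle diagram `c d*`: two vertices are adjacent when
they are joined by a cup of `c` or a cap of `d*`. -/
def adjArc (c d : CupDiagram) (v w : ℤ) : Prop :=
  (v, w) ∈ c.cups ∨ (w, v) ∈ c.cups ∨ (v, w) ∈ d.cups ∨ (w, v) ∈ d.cups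

/-- `S` is a connected component of the circle diagram `c d*`. -/
def IsComponent (c d : CupDiagram) (S : Set ℤ) : Prop :=
  ∃ v ∈ S, S = {w | Relation.ReflTransGen (adjArc c d) v w}

/-- `S` is a circle of the circle diagram `c d*`: a connected component containing
no ray. -/
def IsCircle (c d : CupDiagram) (S : Set ℤ) : Prop :=
  IsComponent c d S ∧ ∀ v ∈ S, v ∉ c.rays ∧ v ∉ d.rays

/-- The degree of the oriented circle diagram `c n d*`: the number of clockwise cups
of `c n` plus the number of clockwise caps of `n d*`. -/
noncomputable def degCirc (c d : CupDiagram) (n : Weight) : ℕ :=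
  {p ∈ c.cups | n.lab p.2 = Symb.dn}.ncard + {p ∈ d.cups | n.lab p.2 = Symb.dn}.ncard

/-- The position `p_Λ(i)` of `i` in the block of `l`. -/
noncomputable def posn (l : Weight) (i : ℤ) : ℕ :=
  {j | j ≤ i ∧ (l.lab j = Symb.up ∨ l.lab j = Symb.dn)}.ncard +
    2 * {j | j ≤ i ∧ l.lab j = Symb.times}.ncard

/-- The distance `d_Λ(γ) = |p_Λ(i) − p_Λ(j)|` of an arc `γ = {i, j}`. -/
noncomputable def arcDist (l : Weight) (i j : ℤ) : ℕ := ((posn l i : ℤ) - (posn l j : ℤ)).natAbs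


namespace CupDiagram

/-- `c` is compatible with the vertex set `V`, and labelling it by `f` makes every cup
anticlockwise and no `∨`-ray lies to the left of an `∧`-ray. -/
def IsAnticlockwise (c : CupDiagram) (f : ℤ → Symb) (V : Set ℤ) : Prop :=
  c.IsCompatible V ∧ (∀ p ∈ c.cups, f p.1 = Symb.dn ∧ f p.2 = Symb.up) ∧
  (∀ i ∈ c.rays, ∀ j ∈ c.rays, i < j → ¬(f i = Symb.dn ∧ f j = Symb.up))

/-- An adjacent pair `∨ ∧` of vertices is joined by a cup in every anticlockwise diagram. -/
theorem IsAnticlockwise.mem_cups {c : CupDiagram} {f : ℤ → Symb} {V : Set ℤ}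
    (h : c.IsAnticlockwise f V) {i j : ℤ} (hi : i ∈ V) (hj : j ∈ V) (hij : i < j)
    (fi : f i = Symb.dn) (fj : f j = Symb.up) (hgap : ∀ k ∈ V, ¬(i < k ∧ k < j)) :
    (i, j) ∈ c.cups := by
  obtain ⟨⟨hlt, hmem, -, hcov, -, hcr, hcross, hunder⟩, hlab, hray⟩ := h
  have left : i ∈ c.rays ∨ ∃ b, (i, b) ∈ c.cups := by
    rcases hcov i hi with h | ⟨⟨a, b⟩, hp, rfl | rfl⟩
    · exact .inl h
    · exact .inr ⟨b, hp⟩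
    · have := (hlab _ hp).2
      simp_all
  have right : j ∈ c.rays ∨ ∃ a, (a, j) ∈ c.cups := by
    rcases hcov j hj with h | ⟨⟨a, b⟩, hp, rfl | rfl⟩
    · exact .inl h
    · have := (hlab _ hp).1
      simp_all
    · exact .inr ⟨a, hp⟩
  have right_end : ∀ b, (i, b) ∈ c.cups → b = j ∨ j < b := by
    intro b hb
    have h1 : i < b := hlt _ hb
    have h2 := hgap b (hmem _ hb).2
    omega
  have left_end : ∀ a, (a, j) ∈ c.cups → a = i ∨ a < i := by
    intro a ha
    have h1 : a < j := hlt _ ha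
    have h2 := hgap a (hmem _ ha).1
    omega
  rcases left with hri | ⟨b, hb⟩ <;> rcases right with hrj | ⟨a, ha⟩
  · exact absurd ⟨fi, fj⟩ (hray i hri j hrj hij)
  · rcases left_end a ha with rfl | hai
    · exact ha
    · exact absurd ⟨hai, hij⟩ (hunder _ ha i hri)
  · rcases right_end b hb with rfl | hjb
    · exact hb
    · exact absurd ⟨hij, hjb⟩ (hunder _ hb j hrj)
  · rcases right_end b hb with rfl | hjb
    · exact hb
    rcases left_end a ha with rfl | hai
    · exact ha
    exact absurd ⟨hai, hij, hjb⟩ (hcross _ ha _ hb)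

/-- Removing a cup from an anticlockwise diagram, together with its endpoints. -/
theorem IsAnticlockwise.erase_cup {c : CupDiagram} {f : ℤ → Symb} {V : Set ℤ}
    (h : c.IsAnticlockwise f V) {i j : ℤ} (hc : (i, j) ∈ c.cups) :
    IsAnticlockwise ⟨c.cups \ {(i, j)}, c.rays⟩ f (V \ {i, j}) := by
  obtain ⟨⟨hlt, hmem, hsub, hcov, huniq, hcr, hcross, hunder⟩, hlab, hray⟩ := h
  refine ⟨⟨fun p hp => hlt p hp.1, ?_, ?_, ?_, fun p hp q hq => huniq p hp.1 q hq.1,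
    fun p hp => hcr p hp.1, fun p hp q hq => hcross p hp.1 q hq.1,
    fun p hp => hunder p hp.1⟩, fun p hp => hlab p hp.1, hray⟩
  · rintro p ⟨hp, hne⟩
    have := huniq p hp _ hc
    have := hmem p hp
    simp only [Set.mem_sdiff, Set.mem_insert_iff, Set.mem_singleton_iff] at *
    tauto
  · intro k hk
    have := hcr _ hc
    have := hsub hk
    simp only [Set.mem_sdiff, Set.mem_insert_iff, Set.mem_singleton_iff]
    grind
  · rintro v ⟨hv, hne⟩
    rcases hcov v hv with h | ⟨p, hp, h⟩
    · exact .inl h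
    · refine .inr ⟨p, ⟨hp, ?_⟩, h⟩
      rintro rfl
      exact hne h

/-- Adding a cup that joins two adjacent vertices labelled `∨ ∧`. -/
theorem IsAnticlockwise.insert_cup {c : CupDiagram} {f : ℤ → Symb} {V : Set ℤ} {i j : ℤ}
    (h : c.IsAnticlockwise f (V \ {i, j})) (hi : i ∈ V) (hj : j ∈ V) (hij : i < j)
    (fi : f i = Symb.dn) (fj : f j = Symb.up) (hgap : ∀ k ∈ V, ¬(i < k ∧ k < j)) :
    IsAnticlockwise ⟨insert (i, j) c.cups, c.rays⟩ f V := by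
  obtain ⟨⟨hlt, hmem, hsub, hcov, huniq, hcr, hcross, hunder⟩, hlab, hray⟩ := h
  have hmem' : ∀ p ∈ c.cups, (p.1 ∈ V ∧ p.1 ≠ i ∧ p.1 ≠ j) ∧ p.2 ∈ V ∧ p.2 ≠ i ∧ p.2 ≠ j := by
    simpa using hmem
  have hsub' : ∀ k ∈ c.rays, k ∈ V ∧ k ≠ i ∧ k ≠ j := fun k hk => by simpa using hsub hk
  refine ⟨⟨?_, ?_, fun k hk => (hsub hk).1, ?_, ?_, ?_, ?_, ?_⟩, ?_, hray⟩
  · rintro p (rfl | hp)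
    exacts [hij, hlt p hp]
  · rintro p (rfl | hp)
    exacts [⟨hi, hj⟩, ⟨(hmem p hp).1.1, (hmem p hp).2.1⟩]
  · intro v hv
    by_cases hvi : v = i
    · exact .inr ⟨(i, j), .inl rfl, .inl hvi⟩
    by_cases hvj : v = j
    · exact .inr ⟨(i, j), .inl rfl, .inr hvj⟩
    rcases hcov v ⟨hv, by simp [hvi, hvj]⟩ with h | ⟨p, hp, h⟩
    exacts [.inl h, .inr ⟨p, .inr hp, h⟩]
  · rintro p (rfl | hp) q (rfl | hq)
    · exact fun _ => rfl
    · have := hmem' q hq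
      grind
    · have := hmem' p hp
      grind
    · exact huniq p hp q hq
  · rintro p (rfl | hp)
    · exact ⟨fun h => (hsub' _ h).2.1 rfl, fun h => (hsub' _ h).2.2 rfl⟩
    · exact hcr p hp
  · rintro p (rfl | hp) q (rfl | hq)
    · simp
    · exact fun ⟨h1, h2, _⟩ => hgap _ (hmem' q hq).1.1 ⟨h1, h2⟩
    · exact fun ⟨_, h2, h3⟩ => hgap _ (hmem' p hp).2.1 ⟨h2, h3⟩
    · exact hcross p hp q hq
  · rintro p (rfl | hp) k hk
    · exact hgap k (hsub' k hk).1
    · exact hunder p hp k hk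
  · rintro p (rfl | hp)
    exacts [⟨fi, fj⟩, hlab p hp]

end CupDiagram

/-- If some `∨` lies to the left of some `∧`, then there is an adjacent such pair. -/
theorem exists_adjacent_dn_up {f : ℤ → Symb} {V : Set ℤ}
    (hV : ∀ v ∈ V, f v = Symb.up ∨ f v = Symb.dn)
    (h : ∃ i ∈ V, ∃ j ∈ V, i < j ∧ f i = Symb.dn ∧ f j = Symb.up) :
    ∃ i ∈ V, ∃ j ∈ V, i < j ∧ f i = Symb.dn ∧ f j = Symb.up ∧
      ∀ k ∈ V, ¬(i < k ∧ k < j) := by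
  obtain ⟨i, hi, j, hj, hij, fi, fj⟩ := h
  induction hn : (j - i).toNat using Nat.strong_induction_on generalizing i j with
  | _ n ih =>
    by_cases hgap : ∀ k ∈ V, ¬(i < k ∧ k < j)
    · exact ⟨i, hi, j, hj, hij, fi, fj, hgap⟩
    · push Not at hgap
      obtain ⟨k, hk, hik, hkj⟩ := hgap
      rcases hV k hk with fk | fk
      · exact ih _ (by omega) i hi k hk hik fi fk rfl
      · exact ih _ (by omega) k hk j hj hkj fk fj rfl

open CupDiagram in
theorem existsUnique_isAnticlockwise {f : ℤ → Symb} {V : Set ℤ} (hfin : V.Finite)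
    (hV : ∀ v ∈ V, f v = Symb.up ∨ f v = Symb.dn) :
    ∃! c : CupDiagram, c.IsAnticlockwise f V := by
  induction hn : V.ncard using Nat.strong_induction_on generalizing V with
  | _ n ih =>
    by_cases h : ∃ i ∈ V, ∃ j ∈ V, i < j ∧ f i = Symb.dn ∧ f j = Symb.up
    · obtain ⟨i, hi, j, hj, hij, fi, fj, hgap⟩ := exists_adjacent_dn_up hV h
      have hcard : (V \ {i, j}).ncard < n :=
        hn ▸ Set.ncard_lt_ncard ⟨Set.sdiff_subset, fun hs => (hs hi).2 (.inl rfl)⟩ hfin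
      obtain ⟨c, hc, huniq⟩ := ih _ hcard hfin.sdiff (fun v hv => hV v hv.1) rfl
      refine ⟨⟨insert (i, j) c.cups, c.rays⟩, hc.insert_cup hi hj hij fi fj hgap, ?_⟩
      intro d hd
      have hmem := hd.mem_cups hi hj hij fi fj hgap
      have hdc := huniq _ (hd.erase_cup hmem)
      subst hdc
      ext1
      · simp [Set.insert_eq_of_mem hmem]
      · rfl
    · refine ⟨⟨∅, V⟩, ⟨⟨?_, ?_, subset_rfl, fun v hv => .inl hv, ?_, ?_, ?_, ?_⟩, ?_,
        fun i hi j hj hij hf => h ⟨i, hi, j, hj, hij, hf⟩⟩, ?_⟩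
      iterate 7 simp
      rintro d ⟨⟨hlt, hmem, hsub, hcov, -, -, -, -⟩, hlab, -⟩
      have hcups : d.cups = ∅ := Set.eq_empty_of_forall_notMem fun p hp =>
        h ⟨p.1, (hmem p hp).1, p.2, (hmem p hp).2, hlt p hp, hlab p hp⟩
      ext1
      · exact hcups
      · exact hsub.antisymm fun v hv => by simpa [hcups] using hcov v hv

theorem Weight.finite_vertices (l : Weight) : l.vertices.Finite :=
  l.finite.subset fun i hi => by
    rcases hi with hi | hi <;> simp [hi]

/-- An oriented compatible diagram has degree zero iff all of its cups are anticlockwise. -/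
theorem CupDiagram.isAnticlockwise_iff (c : CupDiagram) (l : Weight) :
    c.IsAnticlockwise l.lab l.vertices ↔
      c.IsCompatible l.vertices ∧ c.Oriented l ∧ c.deg l = 0 := by
  refine and_congr_right fun hc => ?_
  have hfin : {p ∈ c.cups | l.lab p.2 = Symb.dn}.Finite :=
    (l.finite_vertices.prod l.finite_vertices).subset fun p hp => hc.2.1 p hp.1
  rw [CupDiagram.deg, Set.ncard_eq_zero hfin]
  constructor
  · rintro ⟨hlab, hray⟩
    refine ⟨⟨fun p hp => .inl (hlab p hp), fun k hk => hc.2.2.1 hk, hray⟩, ?_⟩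
    refine Set.eq_empty_of_forall_notMem fun p hp => ?_
    simpa [(hlab p hp.1).2] using hp.2
  · rintro ⟨⟨hlab, -, hray⟩, hempty⟩
    refine ⟨fun p hp => (hlab p hp).resolve_right fun hcw => ?_, hray⟩
    exact Set.eq_empty_iff_forall_notMem.mp hempty p ⟨hp, hcw.2⟩

/-- Existence and uniqueness of `underline λ`: for every weight `λ` (with `Λ` its
block) there is a unique cup diagram `c` compatible with `Λ` such that `cλ` is
oriented and `deg(cλ) = 0`. -/
theorem underline_exists_unique (l : Weight) :
    ∃! c : CupDiagram, c.IsCompatible l.vertices ∧ c.Oriented l ∧ c.deg l = 0 := by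
  simpa only [← CupDiagram.isAnticlockwise_iff] using
    existsUnique_isAnticlockwise l.finite_vertices fun _ hv => hv

end BK
end

section
/- Let Λ be a balanced block. For every cup diagram c compatible with Λ containing no rays there exists a unique λ ∈ Λ such that cλ is oriented and deg(cλ) = 0, and for this λ one has underline λ = c. Consequently, writing Λ° = {λ ∈ Λ : underline λ contains no rays}, the assignment λ ↦ underline λ is a bijection from Λ° onto the set of cup diagrams compatible with Λ containing no rays. -/
namespace BK

namespace Weight

theorem Equiv.vertices_eq {l m : Weight} (h : l.Equiv m) : l.vertices = m.vertices := by
  ext i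
  have hc := h.1 i
  have ht := h.2.1 i
  simp only [vertices, Set.mem_ofPred_eq]
  cases hl : l.lab i <;> cases hm : m.lab i <;> simp_all

theorem finite_vertices_s8 (l : Weight) : l.vertices.Finite := by
  refine l.finite.subset fun i hi => ?_
  rcases hi with hi | hi <;> simp [hi]

theorem ncard_up_add_ncard_dn (l : Weight) :
    {i | l.lab i = Symb.up}.ncard + {i | l.lab i = Symb.dn}.ncard = l.vertices.ncard := by
  have hup : {i | l.lab i = Symb.up}.Finite := l.finite_vertices_s8.subset fun i hi => Or.inl hi
  have hdn : {i | l.lab i = Symb.dn}.Finite := l.finite_vertices_s8.subset fun i hi => Or.inr hi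
  rw [← Set.ncard_union_eq _ hup hdn]
  · rfl
  · rw [Set.disjoint_left]
    intro i hi hi'
    simp_all

theorem ext_lab {l m : Weight} (h : ∀ i, l.lab i = m.lab i) : l = m := by
  cases l
  cases m
  simpa [funext_iff] using h

end Weight

namespace CupDiagram

variable {c d : CupDiagram} {V : Set ℤ} {l m : Weight}

theorem IsCompatible.finite_cups (hc : c.IsCompatible V) (hV : V.Finite) : c.cups.Finite :=
  (hV.prod hV).subset fun p hp => ⟨(hc.2.1 p hp).1, (hc.2.1 p hp).2⟩

/-- An oriented diagram has degree zero exactly when every cup is anticlockwise; this is the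
forward direction. -/
theorem Oriented.lab_cup (ho : c.Oriented l) (hfin : c.cups.Finite) (hdeg : c.deg l = 0)
    {p : ℤ × ℤ} (hp : p ∈ c.cups) : l.lab p.1 = Symb.dn ∧ l.lab p.2 = Symb.up := by
  have hempty : {p ∈ c.cups | l.lab p.2 = Symb.dn} = ∅ :=
    (Set.ncard_eq_zero (hfin.subset fun _ h => h.1)).1 hdeg
  rcases ho.1 p hp with h | h
  · exact h
  · exact absurd (show p ∈ {p ∈ c.cups | l.lab p.2 = Symb.dn} from ⟨hp, h.2⟩) (by simp [hempty])

theorem IsCompatible.exists_cup (hc : c.IsCompatible V) (hr : c.rays = ∅) {v : ℤ} (hv : v ∈ V) :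
    ∃ p ∈ c.cups, v = p.1 ∨ v = p.2 := by
  simpa [hr] using hc.2.2.2.1 v hv

/-- A rayless cup diagram determines the anticlockwise weight orienting it within a block. -/
theorem eq_of_oriented_of_deg_eq_zero (hc : c.IsCompatible l.vertices) (hr : c.rays = ∅)
    (hlm : ∀ i, (l.lab i = Symb.circ ↔ m.lab i = Symb.circ) ∧
      (l.lab i = Symb.times ↔ m.lab i = Symb.times))
    (hl : c.Oriented l) (hl0 : c.deg l = 0) (hm : c.Oriented m) (hm0 : c.deg m = 0) : l = m := by
  have hfin := hc.finite_cups l.finite_vertices_s8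
  refine Weight.ext_lab fun i => ?_
  by_cases hi : i ∈ l.vertices
  · obtain ⟨p, hp, rfl | rfl⟩ := hc.exists_cup hr hi
    · rw [(hl.lab_cup hfin hl0 hp).1, (hm.lab_cup hfin hm0 hp).1]
    · rw [(hl.lab_cup hfin hl0 hp).2, (hm.lab_cup hfin hm0 hp).2]
  · have h := hlm i
    simp only [Weight.vertices, Set.mem_ofPred_eq] at hi
    cases hli : l.lab i <;> simp_all

open Classical in
/-- The weight obtained from `l` by relabelling all cups of `c` anticlockwise. -/
noncomputable def anticlockwise (c : CupDiagram) (l : Weight) (hc : c.IsCompatible l.vertices) :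
    Weight where
  lab i := if ∃ p ∈ c.cups, i = p.2 then Symb.up
    else if ∃ p ∈ c.cups, i = p.1 then Symb.dn else l.lab i
  finite := by
    refine (l.finite.union l.finite_vertices_s8).subset fun i hi => ?_
    simp only [Set.mem_ofPred_eq] at hi
    split_ifs at hi with h₂ h₁
    · obtain ⟨p, hp, rfl⟩ := h₂
      exact Or.inr (hc.2.1 p hp).2
    · obtain ⟨p, hp, rfl⟩ := h₁
      exact Or.inr (hc.2.1 p hp).1
    · exact Or.inl hi

theorem anticlockwise_lab_snd (hc : c.IsCompatible l.vertices) {p : ℤ × ℤ} (hp : p ∈ c.cups) :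
    (c.anticlockwise l hc).lab p.2 = Symb.up :=
  if_pos ⟨p, hp, rfl⟩

theorem anticlockwise_lab_fst (hc : c.IsCompatible l.vertices) {p : ℤ × ℤ} (hp : p ∈ c.cups) :
    (c.anticlockwise l hc).lab p.1 = Symb.dn := by
  have h : ¬ ∃ q ∈ c.cups, p.1 = q.2 := by
    rintro ⟨q, hq, h⟩
    have hlt := hc.1 p hp
    rw [← hc.2.2.2.2.1 p hp q hq (Or.inr (Or.inl h))] at h
    omega
  exact (if_neg h).trans (if_pos ⟨p, hp, rfl⟩)

theorem anticlockwise_lab_of_notMem (hc : c.IsCompatible l.vertices) {i : ℤ}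
    (hi : i ∉ l.vertices) : (c.anticlockwise l hc).lab i = l.lab i := by
  have h₂ : ¬ ∃ p ∈ c.cups, i = p.2 := by
    rintro ⟨p, hp, rfl⟩
    exact hi (hc.2.1 p hp).2
  have h₁ : ¬ ∃ p ∈ c.cups, i = p.1 := by
    rintro ⟨p, hp, rfl⟩
    exact hi (hc.2.1 p hp).1
  exact (if_neg h₂).trans (if_neg h₁)

theorem anticlockwise_oriented (hc : c.IsCompatible l.vertices) (hr : c.rays = ∅) :
    c.Oriented (c.anticlockwise l hc) :=
  ⟨fun _ hp => Or.inl ⟨anticlockwise_lab_fst hc hp, anticlockwise_lab_snd hc hp⟩,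
    by simp [hr], by simp [hr]⟩

theorem anticlockwise_deg (hc : c.IsCompatible l.vertices) :
    c.deg (c.anticlockwise l hc) = 0 := by
  have h : {p ∈ c.cups | (c.anticlockwise l hc).lab p.2 = Symb.dn} = ∅ := by
    ext p
    simp only [Set.mem_ofPred_eq, Set.mem_empty_iff_false, iff_false, not_and]
    intro hp
    simp [anticlockwise_lab_snd hc hp]
  simp [deg, h]

/-- A weight all of whose vertices lie on anticlockwise cups has as many `∧`'s as `∨`'s. -/
theorem ncard_up_eq_ncard_dn (hc : c.IsCompatible l.vertices) (hr : c.rays = ∅)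
    (hl : ∀ p ∈ c.cups, l.lab p.1 = Symb.dn ∧ l.lab p.2 = Symb.up) :
    {i | l.lab i = Symb.up}.ncard = {i | l.lab i = Symb.dn}.ncard := by
  have hup : {i | l.lab i = Symb.up} = Prod.snd '' c.cups := by
    ext i
    constructor
    · intro hi
      obtain ⟨p, hp, rfl | rfl⟩ := hc.exists_cup hr (Or.inl hi)
      · exact absurd ((hl p hp).1.symm.trans hi) (by simp)
      · exact ⟨p, hp, rfl⟩
    · rintro ⟨p, hp, rfl⟩
      exact (hl p hp).2
  have hdn : {i | l.lab i = Symb.dn} = Prod.fst '' c.cups := by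
    ext i
    constructor
    · intro hi
      obtain ⟨p, hp, rfl | rfl⟩ := hc.exists_cup hr (Or.inr hi)
      · exact ⟨p, hp, rfl⟩
      · exact absurd ((hl p hp).2.symm.trans hi) (by simp)
    · rintro ⟨p, hp, rfl⟩
      exact (hl p hp).1
  rw [hup, hdn, Set.InjOn.ncard_image, Set.InjOn.ncard_image]
  · exact fun p hp q hq h => hc.2.2.2.2.1 p hp q hq (Or.inl h)
  · exact fun p hp q hq h => hc.2.2.2.2.1 p hp q hq (Or.inr (Or.inr (Or.inr h)))

theorem equiv_anticlockwise (hc : c.IsCompatible l.vertices) (hr : c.rays = ∅)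
    (hbal : l.Balanced) : l.Equiv (c.anticlockwise l hc) := by
  have hlab : ∀ i ∈ l.vertices, (c.anticlockwise l hc).lab i = Symb.up ∨
      (c.anticlockwise l hc).lab i = Symb.dn := by
    intro i hi
    obtain ⟨p, hp, rfl | rfl⟩ := hc.exists_cup hr hi
    · exact Or.inr (anticlockwise_lab_fst hc hp)
    · exact Or.inl (anticlockwise_lab_snd hc hp)
  have hiff : ∀ s, s ≠ Symb.up → s ≠ Symb.dn →
      ∀ i, l.lab i = s ↔ (c.anticlockwise l hc).lab i = s := by
    intro s hs₁ hs₂ i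
    by_cases hi : i ∈ l.vertices
    · have h₁ := hlab i hi
      have h₂ : l.lab i = Symb.up ∨ l.lab i = Symb.dn := hi
      grind
    · rw [anticlockwise_lab_of_notMem hc hi]
  have hV : (c.anticlockwise l hc).vertices = l.vertices := by
    ext i
    refine ⟨fun h => ?_, hlab i⟩
    by_contra hi
    simp only [Weight.vertices, Set.mem_ofPred_eq, anticlockwise_lab_of_notMem hc hi] at h
    exact hi h
  refine ⟨hiff _ (by simp) (by simp), hiff _ (by simp) (by simp), ?_⟩
  have h₁ := l.ncard_up_add_ncard_dn
  have h₂ := (c.anticlockwise l hc).ncard_up_add_ncard_dn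
  have h₃ := ncard_up_eq_ncard_dn (l := c.anticlockwise l hc) (by rwa [hV]) hr
    fun p hp => ⟨anticlockwise_lab_fst hc hp, anticlockwise_lab_snd hc hp⟩
  rw [hV] at h₂
  simp only [Weight.Balanced, Weight.upNum, Weight.downNum] at hbal
  omega

/-- If a rayless diagram `c` and a diagram `d` are both anticlockwise for `l`, then every cup
of `c` is a cup of `d`; the proof is by induction on the width of the cup. -/
theorem cups_subset_of_anticlockwise (hc : c.IsCompatible V) (hr : c.rays = ∅)
    (hd : d.IsCompatible V) (hdl : d.Oriented l)
    (hcup : ∀ p ∈ c.cups, l.lab p.1 = Symb.dn ∧ l.lab p.2 = Symb.up)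
    (hdup : ∀ p ∈ d.cups, l.lab p.1 = Symb.dn ∧ l.lab p.2 = Symb.up) :
    c.cups ⊆ d.cups := by
  suffices H : ∀ n : ℕ, ∀ p ∈ c.cups, (p.2 - p.1).toNat = n → p ∈ d.cups from
    fun p hp => H _ p hp rfl
  intro n
  induction n using Nat.strong_induction_on with
  | _ n ih =>
  rintro ⟨i, j⟩ hp hn
  obtain ⟨hclt, hcV, -, -, hcuniq, -, hccross, -⟩ := id hc
  obtain ⟨hdlt, hdV, -, hdcov, hduniq, hdray, hdcross, hdunder⟩ := id hd
  have hij : i < j := hclt _ hp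
  obtain ⟨hiV, hjV⟩ := hcV _ hp
  obtain ⟨hli, hlj⟩ := hcup _ hp
  simp only at hn hiV hjV hli hlj
  -- Vertices strictly inside the cup are matched strictly inside it, in `d` too.
  have inside : ∀ v ∈ V, i < v → v < j →
      ∃ q ∈ d.cups, (v = q.1 ∨ v = q.2) ∧ i < q.1 ∧ q.2 < j := by
    intro v hv hiv hvj
    obtain ⟨q, hq, hvq⟩ := hc.exists_cup hr hv
    have hlt := hclt q hq
    have hne : (i, j) ≠ q := by
      rintro rfl
      simp only at hvq
      omega
    have h₁ := hccross _ hp q hq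
    have h₂ := hccross q hq _ hp
    have h₃ := mt (hcuniq _ hp q hq) hne
    simp only at h₁ h₂ h₃
    have hin : i < q.1 ∧ q.2 < j := by omega
    exact ⟨q, ih _ (by omega) q hq rfl, hvq, hin⟩
  -- A cup of `d` starting at `i` ends at `j` or beyond.
  have hstart : ∀ m, (i, m) ∈ d.cups → j ≤ m := by
    intro m hm
    by_contra hmj
    have hlt := hdlt _ hm
    simp only at hlt
    obtain ⟨q, hq, hvq, hin⟩ := inside m (hdV _ hm).2 hlt (by omega)
    have := hduniq _ hm q hq (Or.inr (Or.inr hvq))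
    subst this
    simp at hin
  have hcovi : i ∈ d.rays ∨ ∃ m, (i, m) ∈ d.cups := by
    rcases hdcov i hiV with h | ⟨⟨a, b⟩, hq, rfl | rfl⟩
    · exact Or.inl h
    · exact Or.inr ⟨b, hq⟩
    · exact absurd ((hdup _ hq).2.symm.trans hli) (by simp)
  rcases hdcov j hjV with hj | ⟨⟨k, b⟩, hq, hjq⟩
  · rcases hcovi with hi | ⟨m, hm⟩
    · exact absurd ⟨hli, hlj⟩ (hdl.2.2 i hi j hj hij)
    · have h₁ := hstart m hm
      have h₂ := hdunder _ hm j hj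
      have h₃ : m ≠ j := by
        rintro rfl
        exact (hdray _ hm).2 hj
      simp only at h₂
      omega
  · obtain rfl | rfl := hjq
    · exact absurd ((hdup _ hq).1.symm.trans hlj) (by simp)
    have hkj := hdlt _ hq
    simp only at hkj
    rcases lt_trichotomy k i with hki | rfl | hik
    · rcases hcovi with hi | ⟨m, hm⟩
      · exact absurd ⟨hki, hij⟩ (hdunder _ hq i hi)
      · have h₁ := hstart m hm
        have h₂ := hdcross _ hq _ hm
        simp only at h₂
        obtain rfl : m = j := by omega
        exact hm
    · exact hq
    · obtain ⟨q, hq', hvq, hin⟩ := inside k (hdV _ hq).1 hik hkj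
      have := hduniq _ hq q hq' (by simp only; tauto)
      subst this
      simp at hin

/-- If a rayless diagram is anticlockwise for `l`, it is the only such diagram. -/
theorem eq_of_anticlockwise (hc : c.IsCompatible V) (hr : c.rays = ∅)
    (hd : d.IsCompatible V) (hdl : d.Oriented l)
    (hcup : ∀ p ∈ c.cups, l.lab p.1 = Symb.dn ∧ l.lab p.2 = Symb.up)
    (hdup : ∀ p ∈ d.cups, l.lab p.1 = Symb.dn ∧ l.lab p.2 = Symb.up) : d = c := by
  have hsub := cups_subset_of_anticlockwise hc hr hd hdl hcup hdup
  refine CupDiagram.ext (Set.Subset.antisymm (fun p hp => ?_) hsub) ?_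
  · obtain ⟨q, hq, h⟩ := hc.exists_cup hr (hd.2.1 p hp).1
    rwa [hd.2.2.2.2.1 p hp q (hsub hq) (by tauto)]
  · rw [hr, Set.eq_empty_iff_forall_notMem]
    intro v hv
    obtain ⟨q, hq, rfl | rfl⟩ := hc.exists_cup hr (hd.2.2.1 hv)
    · exact (hd.2.2.2.2.2.1 q (hsub hq)).1 hv
    · exact (hd.2.2.2.2.2.1 q (hsub hq)).2 hv

end CupDiagram

/-- Let `Λ` be a balanced block (represented by `l0`).  Every cup diagram `c`
compatible with `Λ` containing no rays is `underline λ` for a unique `λ ∈ Λ`: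
there is a unique `λ ∈ Λ` with `cλ` oriented and `deg(cλ) = 0`, and for this `λ`
the diagram `c` is the unique cup diagram with the defining property of
`underline λ`.  Moreover the assignment `λ ↦ underline λ` is injective, so that
`λ ↦ underline λ` is a bijection from `Λ° = {λ ∈ Λ : underline λ has no rays}`
onto the set of cup diagrams compatible with `Λ` containing no rays. -/
theorem rayless_cup_diagrams_biject_with_weights (l0 : Weight) (hbal : l0.Balanced) :
    (∀ c : CupDiagram, c.IsCompatible l0.vertices → c.rays = ∅ →
      (∃! l : Weight, l0.Equiv l ∧ c.Oriented l ∧ c.deg l = 0) ∧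
      (∀ l : Weight, l0.Equiv l → c.Oriented l → c.deg l = 0 →
        ∀ c' : CupDiagram, c'.IsCompatible l0.vertices → c'.Oriented l → c'.deg l = 0 →
          c' = c)) ∧
    (∀ l l' : Weight, l0.Equiv l → l0.Equiv l' →
      ∀ c : CupDiagram, IsLowerDiagram c l → IsLowerDiagram c l' → c.rays = ∅ → l = l') := by
  have unique : ∀ l l' : Weight, l0.Equiv l → l0.Equiv l' → ∀ c : CupDiagram,
      c.IsCompatible l0.vertices → c.rays = ∅ → c.Oriented l → c.deg l = 0 →
      c.Oriented l' → c.deg l' = 0 → l = l' := by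
    intro l l' hl hl' c hc hr ho h0 ho' h0'
    rw [hl.vertices_eq] at hc
    exact CupDiagram.eq_of_oriented_of_deg_eq_zero hc hr
      (fun i => ⟨(hl.1 i).symm.trans (hl'.1 i), (hl.2.1 i).symm.trans (hl'.2.1 i)⟩) ho h0 ho' h0'
  refine ⟨fun c hc hr => ⟨⟨c.anticlockwise l0 hc, ⟨CupDiagram.equiv_anticlockwise hc hr hbal,
    CupDiagram.anticlockwise_oriented hc hr, CupDiagram.anticlockwise_deg hc⟩, ?_⟩, ?_⟩, ?_⟩
  · rintro l ⟨hl, ho, h0⟩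
    exact unique _ _ hl (CupDiagram.equiv_anticlockwise hc hr hbal) c hc hr ho h0
      (CupDiagram.anticlockwise_oriented hc hr) (CupDiagram.anticlockwise_deg hc)
  · intro l _ ho h0 c' hc' ho' h0'
    exact CupDiagram.eq_of_anticlockwise hc hr hc' ho'
      (fun _ => ho.lab_cup (hc.finite_cups l0.finite_vertices_s8) h0)
      (fun _ => ho'.lab_cup (hc'.finite_cups l0.finite_vertices_s8) h0')
  · rintro l l' hl hl' c ⟨hc, ho, h0⟩ ⟨-, ho', h0'⟩ hr
    rw [← hl.vertices_eq] at hc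
    exact unique l l' hl hl' c hc hr ho h0 ho' h0'

end BK
end

section
/- Let Λ be a block. The set Λ° = {λ ∈ Λ : underline λ contains no rays} is nonempty if and only if Λ is balanced, i.e. if and only if up(Λ) = down(Λ). -/
namespace BK

theorem Weight.finite_setOf_lab_eq (l : Weight) {s : Symb} (hs : s ≠ Symb.circ) :
    {i | l.lab i = s}.Finite :=
  l.finite.subset fun i (hi : l.lab i = s) => by simpa [hi] using hs

theorem Weight.vertices_eq_union (l : Weight) :
    l.vertices = {i | l.lab i = Symb.up} ∪ {i | l.lab i = Symb.dn} := rfl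

theorem Weight.ncard_vertices (l : Weight) :
    l.vertices.ncard = {i | l.lab i = Symb.up}.ncard + {i | l.lab i = Symb.dn}.ncard := by
  rw [l.vertices_eq_union, Set.ncard_union_eq _ (l.finite_setOf_lab_eq (by simp))
    (l.finite_setOf_lab_eq (by simp))]
  rw [Set.disjoint_left]
  intro i (hi : l.lab i = Symb.up) (hi' : l.lab i = Symb.dn)
  simp [hi] at hi'

theorem Weight.balanced_iff (l : Weight) :
    l.Balanced ↔ {i | l.lab i = Symb.up}.ncard = {i | l.lab i = Symb.dn}.ncard := by
  simp [Weight.Balanced, Weight.upNum, Weight.downNum]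

theorem Weight.Equiv.vertices_eq_s9 {l m : Weight} (h : l.Equiv m) : l.vertices = m.vertices := by
  ext i
  have h1 := h.1 i
  have h2 := h.2.1 i
  simp only [Weight.vertices, Set.mem_ofPred_eq]
  cases hl : l.lab i <;> cases hm : m.lab i <;> simp_all

/-- Balancedness is an invariant of the block. -/
theorem Weight.Equiv.balanced_iff {l m : Weight} (h : l.Equiv m) :
    l.Balanced ↔ m.Balanced := by
  have hv := congrArg Set.ncard h.vertices_eq_s9
  rw [l.ncard_vertices, m.ncard_vertices] at hv
  have hu := h.2.2
  rw [l.balanced_iff, m.balanced_iff]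
  omega

/-- In a lower diagram every cup is anticlockwise. -/
theorem IsLowerDiagram.lab_cup {c : CupDiagram} {l : Weight} (h : IsLowerDiagram c l)
    {p : ℤ × ℤ} (hp : p ∈ c.cups) : l.lab p.1 = Symb.dn ∧ l.lab p.2 = Symb.up := by
  obtain ⟨hc, ho, hd⟩ := h
  refine (ho.1 p hp).resolve_right fun hcw => ?_
  have hfin : {p ∈ c.cups | l.lab p.2 = Symb.dn}.Finite :=
    (l.finite_vertices.prod l.finite_vertices).subset fun q hq => hc.2.1 q hq.1
  have hempty := (Set.ncard_eq_zero hfin).1 hd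
  exact Set.notMem_empty p (hempty ▸ ⟨hp, hcw.2⟩)

/-- If the lower diagram of a weight has no rays, its cups match `∨`'s with `∧`'s. -/
theorem IsLowerDiagram.balanced {c : CupDiagram} {l : Weight} (h : IsLowerDiagram c l)
    (hr : c.rays = ∅) : l.Balanced := by
  obtain ⟨-, -, -, hcover, hunique, -⟩ := h.1
  have hup : {i | l.lab i = Symb.up} = Prod.snd '' c.cups := by
    ext i
    constructor
    · intro (hi : l.lab i = Symb.up)
      obtain hi' | ⟨p, hp, rfl | rfl⟩ := hcover i (Or.inl hi)
      · simp [hr] at hi'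
      · simp [(h.lab_cup hp).1] at hi
      · exact ⟨p, hp, rfl⟩
    · rintro ⟨p, hp, rfl⟩
      exact (h.lab_cup hp).2
  have hdn : {i | l.lab i = Symb.dn} = Prod.fst '' c.cups := by
    ext i
    constructor
    · intro (hi : l.lab i = Symb.dn)
      obtain hi' | ⟨p, hp, rfl | rfl⟩ := hcover i (Or.inr hi)
      · simp [hr] at hi'
      · exact ⟨p, hp, rfl⟩
      · simp [(h.lab_cup hp).2] at hi
    · rintro ⟨p, hp, rfl⟩
      exact (h.lab_cup hp).1
  rw [l.balanced_iff, hup, hdn,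
    Set.InjOn.ncard_image fun p hp q hq hpq => hunique p hp q hq (by simp [hpq]),
    Set.InjOn.ncard_image fun p hp q hq hpq => hunique p hp q hq (by simp [hpq])]

theorem exists_strictMonoOn_image_Iio_eq {V : Set ℤ} (hV : V.Finite) :
    ∃ f : ℕ → ℤ, StrictMonoOn f (Set.Iio V.ncard) ∧ f '' Set.Iio V.ncard = V := by
  lift V to Finset ℤ using hV
  rw [Set.ncard_coe_finset]
  let e := V.orderEmbOfFin rfl
  refine ⟨fun i => if h : i < V.card then e ⟨i, h⟩ else 0, ?_, ?_⟩
  · intro i (hi : i < V.card) j (hj : j < V.card) hij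
    simpa [hi, hj] using hij
  · rw [← V.range_orderEmbOfFin rfl]
    ext v
    constructor
    · rintro ⟨i, hi : i < V.card, rfl⟩
      exact ⟨⟨i, hi⟩, by simp [hi, e]⟩
    · rintro ⟨i, rfl⟩
      exact ⟨i, i.2, by simp [e]⟩

/-- The weight in the block of `l` with `∧`'s exactly at the positions in `U`. -/
noncomputable def Weight.relabel (l : Weight) (U : Set ℤ) : Weight where
  lab i := open Classical in
    if i ∈ l.vertices then (if i ∈ U then Symb.up else Symb.dn) else l.lab i
  finite := l.finite.subset fun i hi hl => hi <| by
    simp [Weight.vertices, hl]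

theorem Weight.lab_relabel_eq_up (l : Weight) (U : Set ℤ) (i : ℤ) :
    (l.relabel U).lab i = Symb.up ↔ i ∈ l.vertices ∧ i ∈ U := by
  by_cases hi : i ∈ l.vertices <;> by_cases hU : i ∈ U <;> simp [Weight.relabel, hi, hU] <;>
  exact fun h => hi (Or.inl h)

theorem Weight.lab_relabel_eq_dn (l : Weight) (U : Set ℤ) (i : ℤ) :
    (l.relabel U).lab i = Symb.dn ↔ i ∈ l.vertices ∧ i ∉ U := by
  by_cases hi : i ∈ l.vertices <;> by_cases hU : i ∈ U <;> simp [Weight.relabel, hi, hU] <;>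
  exact fun h => hi (Or.inr h)

theorem Weight.equiv_relabel (l : Weight) {U : Set ℤ} (hU : U ⊆ l.vertices)
    (hcard : {i | l.lab i = Symb.up}.ncard = U.ncard) : l.Equiv (l.relabel U) := by
  have hoff (s : Symb) (hu : s ≠ Symb.up) (hd : s ≠ Symb.dn) (i : ℤ) :
      l.lab i = s ↔ (l.relabel U).lab i = s := by
    by_cases hi : i ∈ l.vertices
    · have hl : l.lab i ≠ s := by rcases hi with hi | hi <;> rw [hi] <;> tauto
      by_cases hiU : i ∈ U <;> simp [Weight.relabel, hi, hiU, hl, hu.symm, hd.symm]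
    · simp [Weight.relabel, hi]
  refine ⟨hoff _ (by simp) (by simp), hoff _ (by simp) (by simp), ?_⟩
  rw [hcard]
  congr 1
  ext i
  rw [Set.mem_ofPred_eq, l.lab_relabel_eq_up]
  exact ⟨fun hi => ⟨hU hi, hi⟩, And.right⟩

/-- A balanced block contains the weight `∨∧∨∧⋯∨∧`, whose lower diagram joins
neighbouring vertices. -/
theorem Weight.Balanced.exists_rayless {l : Weight} (h : l.Balanced) :
    ∃ m : Weight, l.Equiv m ∧ ∃ c : CupDiagram, IsLowerDiagram c m ∧ c.rays = ∅ := by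
  obtain ⟨f, hmono, himage⟩ := exists_strictMonoOn_image_Iio_eq l.finite_vertices
  obtain ⟨n, hn⟩ : ∃ n, {i | l.lab i = Symb.up}.ncard = n := ⟨_, rfl⟩
  have hcard : l.vertices.ncard = 2 * n := by
    have := l.balanced_iff.1 h
    rw [l.ncard_vertices]
    omega
  rw [hcard] at hmono himage
  have hmem {i : ℕ} (hi : i < 2 * n) : f i ∈ l.vertices := himage ▸ ⟨i, hi, rfl⟩
  have hlt {i j : ℕ} (hi : i < 2 * n) (hj : j < 2 * n) : f i < f j ↔ i < j :=
    hmono.lt_iff_lt hi hj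
  have heq {i j : ℕ} (hi : i < 2 * n) (hj : j < 2 * n) : f i = f j ↔ i = j :=
    hmono.injOn.eq_iff hi hj
  let U : Set ℤ := (fun k => f (2 * k + 1)) '' Set.Iio n
  have hodd {k : ℕ} (hk : k < n) : f (2 * k + 1) ∈ U := ⟨k, hk, rfl⟩
  have heven {k : ℕ} (hk : k < n) : f (2 * k) ∉ U := by
    rintro ⟨j, hj : j < n, hjk⟩
    have := (heq (by omega) (by omega)).1 hjk
    omega
  have hUV : U ⊆ l.vertices := by
    rintro _ ⟨k, hk : k < n, rfl⟩
    exact hmem (by omega)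
  have hUcard : U.ncard = n := by
    rw [Set.InjOn.ncard_image, ← Finset.coe_Iio, Set.ncard_coe_finset, Nat.card_Iio]
    intro i (hi : i < n) j (hj : j < n) hij
    have := (heq (by omega) (by omega)).1 hij
    omega
  have hequiv := l.equiv_relabel hUV (hn.trans hUcard.symm)
  let c : CupDiagram := ⟨(fun k => (f (2 * k), f (2 * k + 1))) '' Set.Iio n, ∅⟩
  refine ⟨l.relabel U, hequiv, c, ⟨?_, ?_, ?_⟩, rfl⟩
  · rw [← hequiv.vertices_eq_s9]
    refine ⟨?_, ?_, Set.empty_subset _, ?_, ?_, fun _ _ => ⟨id, id⟩, ?_, fun _ _ _ hk => hk.elim⟩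
    · rintro _ ⟨k, hk : k < n, rfl⟩
      exact (hlt (by omega) (by omega)).2 (by omega)
    · rintro _ ⟨k, hk : k < n, rfl⟩
      exact ⟨hmem (by omega), hmem (by omega)⟩
    · intro v hv
      rw [← himage] at hv
      obtain ⟨i, hi : i < 2 * n, rfl⟩ := hv
      refine Or.inr ⟨_, ⟨i / 2, show i / 2 < n by omega, rfl⟩, ?_⟩
      obtain hi2 | hi2 := Nat.mod_two_eq_zero_or_one i
      · exact Or.inl (congrArg f (by omega))
      · exact Or.inr (congrArg f (by omega))
    · rintro _ ⟨i, hi : i < n, rfl⟩ _ ⟨j, hj : j < n, rfl⟩ hij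
      dsimp only at hij
      rw [heq (by omega) (by omega), heq (by omega) (by omega), heq (by omega) (by omega),
        heq (by omega) (by omega)] at hij
      obtain rfl : i = j := by omega
      rfl
    · rintro _ ⟨i, hi : i < n, rfl⟩ _ ⟨j, hj : j < n, rfl⟩ hij
      dsimp only at hij
      rw [hlt (by omega) (by omega), hlt (by omega) (by omega), hlt (by omega) (by omega)] at hij
      omega
  · refine ⟨?_, fun _ hk => hk.elim, fun _ hk => hk.elim⟩
    rintro _ ⟨k, hk : k < n, rfl⟩
    exact Or.inl ⟨(l.lab_relabel_eq_dn U _).2 ⟨hmem (by omega), heven hk⟩,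
      (l.lab_relabel_eq_up U _).2 ⟨hmem (by omega), hodd hk⟩⟩
  · have hempty : {p ∈ c.cups | (l.relabel U).lab p.2 = Symb.dn} = ∅ := by
      refine Set.eq_empty_of_forall_notMem ?_
      rintro _ ⟨⟨k, hk, rfl⟩, hdn⟩
      exact ((l.lab_relabel_eq_dn U _).1 hdn).2 (hodd hk)
    rw [CupDiagram.deg, hempty, Set.ncard_empty]

/-- `Λ°` is nonempty iff the block is balanced: there is a weight `λ` in the block of
`l0` whose cup diagram `underline λ` contains no rays if and only if
`up(Λ) = down(Λ)`. -/
theorem rayless_weight_exists_iff_balanced (l0 : Weight) :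
    (∃ l : Weight, l0.Equiv l ∧ ∃ c : CupDiagram, IsLowerDiagram c l ∧ c.rays = ∅) ↔
      l0.Balanced := by
  constructor
  · rintro ⟨l, hl, c, hc, hr⟩
    exact hl.balanced_iff.2 (hc.balanced hr)
  · exact Weight.Balanced.exists_rayless

end BK
end

section
/- Let Λ be a block, cd* a circle diagram compatible with Λ, C a circle of cd*, and v, w two distinct vertices lying on C. The arcs of C decompose into two arc-paths γ and γ′, each connecting v and w; then d_Λ(γ) ≡ d_Λ(γ′) (mod 2). Hence the dot moving sign (−1)^{d_Λ(γ)} attached to a sequence of pairwise distinct arcs of C connecting v and w is independent of the chosen sequence. -/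
namespace BK

/-- The total distance of a path along consecutive vertices. -/
noncomputable def pathDist (l : Weight) (vs : List ℤ) : ℕ :=
  ((vs.zip vs.tail).map fun q => arcDist l q.1 q.2).sum

/-- `vs` is a path of pairwise distinct arcs of the circle `S` of the circle diagram
`c d*` connecting `v` and `w`: a list of pairwise distinct vertices of `S`, starting at
`v`, ending at `w`, any two consecutive ones joined by an arc. -/
def IsArcPath (c d : CupDiagram) (S : Set ℤ) (v w : ℤ) (vs : List ℤ) : Prop :=
  vs.Chain' (adjArc c d) ∧ vs.head? = some v ∧ vs.getLast? = some w ∧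
    vs.Nodup ∧ ∀ x ∈ vs, x ∈ S

/-- Modulo two the distance of a path only depends on the positions of its endpoints. -/
theorem pathDist_mod_two (l : Weight) {w : ℤ} (vs : List ℤ) (v : ℤ)
    (hw : (v :: vs).getLast? = some w) :
    pathDist l (v :: vs) % 2 = (posn l v + posn l w) % 2 := by
  induction vs generalizing v with
  | nil =>
    obtain rfl : v = w := by simpa using hw
    simp only [pathDist, List.tail_cons, List.zip_nil_right, List.map_nil, List.sum_nil]
    omega
  | cons u us ih =>
    have hu := ih u (by simpa [List.getLast?_cons_cons] using hw)
    have hcons : pathDist l (v :: u :: us) = arcDist l v u + pathDist l (u :: us) := by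
      simp [pathDist]
    rw [hcons, arcDist]
    omega

theorem IsArcPath.pathDist_mod_two {c d : CupDiagram} {S : Set ℤ} {v w : ℤ} {vs : List ℤ}
    (h : IsArcPath c d S v w vs) (l : Weight) :
    pathDist l vs % 2 = (posn l v + posn l w) % 2 := by
  obtain ⟨-, hv, hw, -⟩ := h
  obtain ⟨us, rfl⟩ := List.head?_eq_some_iff.mp hv
  exact BK.pathDist_mod_two l us v hw

/-- Well-definedness of the dot moving sign: for two distinct vertices `v, w` on a
circle `C` of a circle diagram, any two paths of pairwise distinct arcs of `C`
connecting `v` and `w` have distances of equal parity; hence the sign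
`(−1)^{d_Λ(γ)}` is independent of the chosen path. -/
theorem dot_moving_sign_well_defined (l : Weight) (c d : CupDiagram)
    (hc : c.IsCompatible l.vertices) (hd : d.IsCompatible l.vertices)
    (S : Set ℤ) (hS : IsCircle c d S)
    (v w : ℤ) (hv : v ∈ S) (hw : w ∈ S) (hvw : v ≠ w)
    (vs1 vs2 : List ℤ)
    (h1 : IsArcPath c d S v w vs1) (h2 : IsArcPath c d S v w vs2) :
    pathDist l vs1 % 2 = pathDist l vs2 % 2 := by
  rw [h1.pathDist_mod_two l, h2.pathDist_mod_two l]

end BK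
end

section
/- Let Λ be a balanced block and λ ∈ Λ° (i.e. underline λ contains no rays). Then ν = λ is the unique weight ν ∈ Λ such that the circle diagram underline λ ν overline λ is oriented and deg(underline λ ν overline λ) = 0. (This is the combinatorial fact underlying the primitivity of the idempotent 1_λ = underline λ λ overline λ in the Blanchet–Khovanov algebra.) -/
namespace BK

theorem CupDiagram.IsCompatible.finite_cups_s13 {c : CupDiagram} {V : Set ℤ}
    (hc : c.IsCompatible V) (hV : V.Finite) : c.cups.Finite :=
  (hV.prod hV).subset fun p hp => hc.2.1 p hp

/-- An oriented diagram of degree `0` has all its cups anticlockwise. -/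
theorem CupDiagram.Oriented.anticlockwise_of_deg_eq_zero {c : CupDiagram} {n : Weight}
    (ho : c.Oriented n) (hfin : c.cups.Finite) (hdeg : c.deg n = 0) {p : ℤ × ℤ}
    (hp : p ∈ c.cups) : n.lab p.1 = Symb.dn ∧ n.lab p.2 = Symb.up := by
  have hempty : {p ∈ c.cups | n.lab p.2 = Symb.dn} = ∅ :=
    (Set.ncard_eq_zero (hfin.subset (Set.sep_subset _ _))).mp hdeg
  refine (ho.1 p hp).resolve_right fun h => ?_
  exact Set.eq_empty_iff_forall_notMem.mp hempty p ⟨hp, h.2⟩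

/-- Primitivity of the idempotent `1_λ`: for `Λ` a balanced block and `λ ∈ Λ°` (so
`underline λ` has no rays), the weight `λ` itself is the unique `ν ∈ Λ` such that the
circle diagram `underline λ ν overline λ` is oriented and of degree `0`. -/
theorem idempotent_orientation_unique (l : Weight) (hbal : l.Balanced)
    (c : CupDiagram) (hc : IsLowerDiagram c l) (hray : c.rays = ∅) :
    degCirc c c l = 0 ∧
    (∀ n : Weight, l.Equiv n → c.Oriented n → degCirc c c n = 0 → n = l) := by
  obtain ⟨hcomp, hor, hdeg⟩ := hc
  have hfin := hcomp.finite_cups_s13 l.finite_vertices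
  refine ⟨by simpa [degCirc, CupDiagram.deg] using hdeg, fun n hn hon hdn => ?_⟩
  have hdn' : c.deg n = 0 := (Nat.add_eq_zero_iff.mp hdn).1
  have hlab : l.lab = n.lab := by
    funext i
    by_cases hv : i ∈ l.vertices
    · rcases hcomp.2.2.2.1 i hv with hr | ⟨p, hp, hi⟩
      · simp [hray] at hr
      · have hl := hor.anticlockwise_of_deg_eq_zero hfin hdeg hp
        have hn := hon.anticlockwise_of_deg_eq_zero hfin hdn' hp
        rcases hi with rfl | rfl
        · rw [hl.1, hn.1]
        · rw [hl.2, hn.2]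
    · cases hi : l.lab i with
      | circ => exact ((hn.1 i).mp hi).symm
      | times => exact ((hn.2.1 i).mp hi).symm
      | dn => exact absurd (Or.inr hi) hv
      | up => exact absurd (Or.inl hi) hv
  cases l
  cases n
  cases hlab
  rfl

end BK
end
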